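/- Let 0 < p ≤ 1/2. The function E₀*(q) = q/p + (1 − q)/(1 − p) is the unique bounded function E : [0,1] → ℝ satisfying the recurrence E(q) = 1 + p·E(q/p) for q ≤ p and E(q) = 1 + (1 − p)·E((q − p)/(1 − p)) for q > p. -/

import Mathlib

/-- `E` is bounded on the unit interval. -/
def BddOnUnit (E : ℝ → ℝ) : Prop :=
  ∃ C : ℝ, ∀ q ∈ Set.Icc (0:ℝ) 1, |E q| ≤ C

/-- `E` satisfies the expected-running-time recurrence `E(q) = 1 + p·E(q/p)` for
`q ≤ p` and `E(q) = 1 + (1-p)·E((q-p)/(1-p))` for `q > p`, on the unit interval. -/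
def QflipTimeRec (p : ℝ) (E : ℝ → ℝ) : Prop :=
  ∀ q ∈ Set.Icc (0:ℝ) 1,
    (q ≤ p → E q = 1 + p * E (q / p)) ∧
    (p < q → E q = 1 + (1 - p) * E ((q - p) / (1 - p)))

lemma bddOnUnit_affine (p : ℝ) : BddOnUnit (fun q => q / p + (1 - q) / (1 - p)) := by
  obtain ⟨C, hC⟩ := isCompact_Icc.exists_bound_of_continuousOn (s := Set.Icc (0:ℝ) 1)
    (f := fun q : ℝ => q / p + (1 - q) / (1 - p)) (by fun_prop)
  exact ⟨C, hC⟩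

lemma qflipTimeRec_affine {p : ℝ} (hp : p ≠ 0) (hp' : 1 - p ≠ 0) :
    QflipTimeRec p (fun q => q / p + (1 - q) / (1 - p)) := by
  refine fun q _ => ⟨fun _ => ?_, fun _ => ?_⟩
  · field_simp
    ring
  · field_simp
    ring

/-- The recurrence contracts the distance between two of its solutions by a factor `1 - p`. -/
lemma QflipTimeRec.exists_abs_sub_le {p : ℝ} (hp : 0 < p) (hp' : p ≤ 1 / 2) {E F : ℝ → ℝ}
    (hE : QflipTimeRec p E) (hF : QflipTimeRec p F) {q : ℝ} (hq : q ∈ Set.Icc (0:ℝ) 1) :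
    ∃ r ∈ Set.Icc (0:ℝ) 1, |E q - F q| ≤ (1 - p) * |E r - F r| := by
  have h1p : 0 < 1 - p := by linarith
  rcases le_or_gt q p with h | h
  · refine ⟨q / p, ⟨div_nonneg hq.1 hp.le, (div_le_one hp).2 h⟩, ?_⟩
    rw [(hE q hq).1 h, (hF q hq).1 h, add_sub_add_left_eq_sub, ← mul_sub, abs_mul,
      abs_of_pos hp]
    gcongr
    linarith
  · refine ⟨(q - p) / (1 - p), ⟨div_nonneg (by linarith) h1p.le,
      (div_le_one h1p).2 (by linarith [hq.2])⟩, ?_⟩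
    rw [(hE q hq).2 h, (hF q hq).2 h, add_sub_add_left_eq_sub, ← mul_sub, abs_mul,
      abs_of_pos h1p]

/-- Two bounded solutions of the recurrence agree on the unit interval. -/
lemma QflipTimeRec.eqOn {p : ℝ} (hp : 0 < p) (hp' : p ≤ 1 / 2) {E F : ℝ → ℝ}
    (hE : QflipTimeRec p E) (hF : QflipTimeRec p F) (hEb : BddOnUnit E) (hFb : BddOnUnit F) :
    Set.EqOn E F (Set.Icc 0 1) := by
  obtain ⟨A, hA⟩ := hEb
  obtain ⟨B, hB⟩ := hFb
  have h1p : 0 ≤ 1 - p := by linarith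
  have bound : ∀ n : ℕ, ∀ q ∈ Set.Icc (0:ℝ) 1, |E q - F q| ≤ (1 - p) ^ n * (A + B) := by
    intro n
    induction n with
    | zero =>
      intro q hq
      simpa using (abs_sub _ _).trans (add_le_add (hA q hq) (hB q hq))
    | succ n ih =>
      intro q hq
      obtain ⟨r, hr, h⟩ := hE.exists_abs_sub_le hp hp' hF hq
      calc |E q - F q| ≤ (1 - p) * |E r - F r| := h
        _ ≤ (1 - p) * ((1 - p) ^ n * (A + B)) := by gcongr; exact ih r hr
        _ = (1 - p) ^ (n + 1) * (A + B) := by ring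
  intro q hq
  have lim : Filter.Tendsto (fun n : ℕ => (1 - p) ^ n * (A + B)) Filter.atTop (nhds 0) := by
    simpa using (tendsto_pow_atTop_nhds_zero_of_lt_one h1p (by linarith)).mul_const (A + B)
  have h0 : |E q - F q| ≤ 0 := ge_of_tendsto' lim fun n => bound n q hq
  exact sub_eq_zero.1 (abs_nonpos_iff.1 h0)

/-- `E₀*(q) = q/p + (1-q)/(1-p)` is the unique bounded function on
`[0,1]` satisfying the expected-running-time recurrence. -/
theorem qflip_time_unique_bounded_solution (p : ℝ) (hp : 0 < p) (hp' : p ≤ 1 / 2) :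
    (BddOnUnit (fun q => q / p + (1 - q) / (1 - p)) ∧
      QflipTimeRec p (fun q => q / p + (1 - q) / (1 - p))) ∧
    ∀ E : ℝ → ℝ, BddOnUnit E → QflipTimeRec p E →
      ∀ q ∈ Set.Icc (0:ℝ) 1, E q = q / p + (1 - q) / (1 - p) := by
  have hrec : QflipTimeRec p (fun q => q / p + (1 - q) / (1 - p)) :=
    qflipTimeRec_affine hp.ne' (by linarith)
  exact ⟨⟨bddOnUnit_affine p, hrec⟩, fun _ hb hE =>
    hE.eqOn hp hp' hrec hb (bddOnUnit_affine p)⟩
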